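/- arXiv:2508.10234 — 3 statements merged into one kernel-verified Lean document; each statement's English description precedes it below -/
import Mathlib

section
/- Let p be a prime and let u be an integer with u² ≡ -1 (mod p). If a and b are integers with a² + b² = p, then a ≡ u·b (mod p) or b ≡ u·a (mod p). -/
theorem sum_of_squares_congruence (p : ℕ) (hp : p.Prime) (u : ℤ)
    (hu : u ^ 2 ≡ -1 [ZMOD p]) (a b : ℤ) (hab : a ^ 2 + b ^ 2 = p) :
    a ≡ u * b [ZMOD p] ∨ b ≡ u * a [ZMOD p] := by
  simp only [Int.modEq_iff_dvd] at hu ⊢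
  obtain ⟨k, hk⟩ := hu
  have hprod : (p : ℤ) ∣ (b + u * a) * (u * a - b) :=
    ⟨-1 - (k * a ^ 2), by linear_combination -hab - a ^ 2 * hk⟩
  rcases (Nat.prime_iff_prime_int.mp hp).dvd_or_dvd hprod with ⟨c, hc⟩ | h
  · exact Or.inl ⟨u * c + k * a, by linear_combination u * hc + a * hk⟩
  · exact Or.inr h
end

section
/- Let p be a prime, let u be an integer with u² ≡ -1 (mod p), and let R = ⌊√p⌋. Then there exists an integer x with 1 ≤ x ≤ R such that the least nonnegative residue of u·x modulo p satisfies 1 ≤ ⟨u·x⟩_p ≤ R. Equivalently, min over 1 ≤ x ≤ ⌊√p⌋ of ⟨u·x⟩_p is less than √p. -/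
/-- The lemma of Thue, by the pigeonhole principle. -/
theorem exists_abs_le_sqrt_dvd (p : ℕ) (hp : 0 < p) (u : ℤ) :
    ∃ a b : ℤ, |a| ≤ (Nat.sqrt p : ℤ) ∧ |b| ≤ (Nat.sqrt p : ℤ) ∧ (a ≠ 0 ∨ b ≠ 0) ∧
      (p : ℤ) ∣ u * a - b := by
  have : NeZero p := ⟨hp.ne'⟩
  set s := Finset.range (Nat.sqrt p + 1) ×ˢ Finset.range (Nat.sqrt p + 1) with hs
  have hcard : (Finset.univ : Finset (ZMod p)).card < s.card := by
    rw [Finset.card_univ, ZMod.card, hs, Finset.card_product, Finset.card_range]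
    exact Nat.lt_succ_sqrt p
  obtain ⟨⟨x, y⟩, hxy, ⟨z, w⟩, hzw, hne, heq⟩ :=
    Finset.exists_ne_map_eq_of_card_lt_of_maps_to hcard
      (f := fun q : ℕ × ℕ => (u : ZMod p) * q.1 - q.2)
      (fun _ _ => Finset.mem_coe.2 (Finset.mem_univ _))
  simp only [hs, Finset.mem_product, Finset.mem_range] at hxy hzw
  refine ⟨x - z, y - w, abs_le.2 ⟨by lia, by lia⟩, abs_le.2 ⟨by lia, by lia⟩, ?_, ?_⟩
  · by_contra! h
    exact hne (Prod.ext (by dsimp only; lia) (by dsimp only; lia))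
  · rw [← ZMod.intCast_zmod_eq_zero_iff_dvd]
    push_cast
    linear_combination heq

theorem exists_small_residue (p : ℕ) (hp : p.Prime) (u : ℤ)
    (hu : u ^ 2 ≡ -1 [ZMOD p]) :
    ∃ x : ℤ, 1 ≤ x ∧ x ≤ (Nat.sqrt p : ℤ) ∧
      1 ≤ (u * x) % (p : ℤ) ∧ (u * x) % (p : ℤ) ≤ (Nat.sqrt p : ℤ) := by
  have hlt : (Nat.sqrt p : ℤ) < p := by exact_mod_cast Nat.sqrt_lt_self hp.one_lt
  have hu' : (p : ℤ) ∣ u ^ 2 + 1 := by simpa using hu.symm.dvd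
  have key : ∀ x y : ℤ, 0 < x → x ≤ (Nat.sqrt p : ℤ) → 0 < y → y ≤ (Nat.sqrt p : ℤ) →
      (p : ℤ) ∣ u * x - y → ∃ x : ℤ, 1 ≤ x ∧ x ≤ (Nat.sqrt p : ℤ) ∧
        1 ≤ (u * x) % (p : ℤ) ∧ (u * x) % (p : ℤ) ≤ (Nat.sqrt p : ℤ) := by
    intro x y hx hxR hy hyR h
    have hmod : (u * x) % (p : ℤ) = y := by
      rw [Int.emod_eq_emod_iff_emod_sub_eq_zero.2 (Int.emod_eq_zero_of_dvd h),
        Int.emod_eq_of_lt hy.le (by lia)]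
    exact ⟨x, hx, hxR, by lia, by lia⟩
  obtain ⟨a, b, ha, hb, hab, h⟩ := exists_abs_le_sqrt_dvd p hp.pos u
  have hrot : (p : ℤ) ∣ u * b + a := by
    rw [show u * b + a = (u ^ 2 + 1) * a - u * (u * a - b) by ring]
    exact dvd_sub (hu'.mul_right a) (h.mul_left u)
  have ha0 : a ≠ 0 := by
    rintro rfl
    have hb0 : b = 0 := Int.eq_zero_of_abs_lt_dvd (by simpa using h) (by lia)
    simp [hb0] at hab
  have hb0 : b ≠ 0 := by
    rintro rfl
    exact ha0 (Int.eq_zero_of_abs_lt_dvd (by simpa using hrot) (by lia))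
  rw [abs_le] at ha hb
  have h' : (p : ℤ) ∣ u * -a - -b := by
    rw [show u * -a - -b = -(u * a - b) by ring]
    exact dvd_neg.2 h
  rcases lt_or_gt_of_ne ha0 with ha1 | ha1 <;> rcases lt_or_gt_of_ne hb0 with hb1 | hb1
  · exact key (-a) (-b) (by lia) (by lia) (by lia) (by lia) h'
  · exact key b (-a) hb1 hb.2 (by lia) (by lia) (by simpa using hrot)
  · refine key (-b) a (by lia) (by lia) ha1 ha.2 ?_
    rw [show u * -b - a = -(u * b + a) by ring]
    exact dvd_neg.2 hrot
  · exact key a b ha1 ha.2 hb1 hb.2 h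
end

section
/- Let p be a prime congruent to 1 modulo 4, let u be an integer with u² ≡ -1 (mod p), and let R = ⌊√p⌋. Then there is at most one integer x with 1 ≤ x ≤ R whose least nonnegative residue ⟨u·x⟩_p modulo p satisfies 1 ≤ ⟨u·x⟩_p ≤ R; that is, if x₁ and x₂ both have this property, then x₁ = x₂. -/
/-- A nonzero vector `(x, u * x % p)` with entries of square less than `p` has squared norm
exactly `p` when `u ^ 2 ≡ -1` modulo `p`. -/
lemma sq_add_sq_emod_eq {p u x R : ℤ} (hu : u ^ 2 ≡ -1 [ZMOD p]) (hR : R * R < p)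
    (hx : 1 ≤ x) (hxR : x ≤ R) (hy : 1 ≤ (u * x) % p) (hyR : (u * x) % p ≤ R) :
    x ^ 2 + ((u * x) % p) ^ 2 = p := by
  have hdvd : p ∣ x ^ 2 + ((u * x) % p) ^ 2 := by
    rw [← Int.modEq_zero_iff_dvd]
    calc x ^ 2 + ((u * x) % p) ^ 2 ≡ x ^ 2 + (u * x) ^ 2 [ZMOD p] :=
          ((Int.mod_modEq _ _).pow 2).add_left _
      _ = x ^ 2 + u ^ 2 * x ^ 2 := by ring
      _ ≡ x ^ 2 + -1 * x ^ 2 [ZMOD p] := (hu.mul_right _).add_left _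
      _ = 0 := by ring
  obtain ⟨k, hk⟩ := hdvd
  have hp : 0 < p := by nlinarith
  have hk0 : 0 < k := by
    by_contra! h
    nlinarith [sq_nonneg ((u * x) % p)]
  have hk2 : k < 2 := by
    by_contra! h
    nlinarith
  obtain rfl : k = 1 := by omega
  simpa using hk

theorem unique_small_residue (p : ℕ) (hp : p.Prime) (hmod : p % 4 = 1)
    (u : ℤ) (hu : u ^ 2 ≡ -1 [ZMOD p])
    (x₁ x₂ : ℤ)
    (hx₁ : 1 ≤ x₁ ∧ x₁ ≤ (Nat.sqrt p : ℤ) ∧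
      1 ≤ (u * x₁) % (p : ℤ) ∧ (u * x₁) % (p : ℤ) ≤ (Nat.sqrt p : ℤ))
    (hx₂ : 1 ≤ x₂ ∧ x₂ ≤ (Nat.sqrt p : ℤ) ∧
      1 ≤ (u * x₂) % (p : ℤ) ∧ (u * x₂) % (p : ℤ) ≤ (Nat.sqrt p : ℤ)) :
    x₁ = x₂ := by
  obtain ⟨h1, h1R, h1y, h1yR⟩ := hx₁
  obtain ⟨h2, h2R, h2y, h2yR⟩ := hx₂
  have hR : (Nat.sqrt p : ℤ) * Nat.sqrt p < p := by
    have hlt : Nat.sqrt p * Nat.sqrt p < p :=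
      lt_of_le_of_ne (Nat.sqrt_le p) fun h => hp.prime.not_isSquare ⟨_, h.symm⟩
    exact_mod_cast hlt
  have e1 := sq_add_sq_emod_eq hu hR h1 h1R h1y h1yR
  have e2 := sq_add_sq_emod_eq hu hR h2 h2R h2y h2yR
  have hcross : (u * x₁) % p * x₂ ≡ (u * x₂) % p * x₁ [ZMOD p] :=
    calc (u * x₁) % p * x₂ ≡ u * x₁ * x₂ [ZMOD p] := (Int.mod_modEq _ _).mul_right _
      _ = u * x₂ * x₁ := by ring
      _ ≡ (u * x₂) % p * x₁ [ZMOD p] := ((Int.mod_modEq _ _).mul_right _).symm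
  generalize (u * x₁) % (p : ℤ) = y₁ at *
  generalize (u * x₂) % (p : ℤ) = y₂ at *
  have heq : y₁ * x₂ = y₂ * x₁ := by
    have l1 : y₁ * x₂ < p := (mul_le_mul h1yR h2R (by omega) (by omega)).trans_lt hR
    have l2 : y₂ * x₁ < p := (mul_le_mul h2yR h1R (by omega) (by omega)).trans_lt hR
    rwa [Int.ModEq, Int.emod_eq_of_lt (by positivity) l1,
      Int.emod_eq_of_lt (by positivity) l2] at hcross
  have hp0 : (p : ℤ) ≠ 0 := by exact_mod_cast hp.ne_zero
  have hsq : x₁ ^ 2 = x₂ ^ 2 := by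
    apply mul_right_cancel₀ hp0
    linear_combination (-x₁ ^ 2) * e2 + x₂ ^ 2 * e1 - (y₁ * x₂ + y₂ * x₁) * heq
  exact (pow_left_inj₀ (by omega) (by omega) two_ne_zero).1 hsq
end
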